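/- Let w be a complex number with Re(w) > 0 and let ξ be a real number with |ξ| < 1/2. Then the Fourier transform of x ↦ binom(w, x) at ξ satisfies ∫_{−∞}^{∞} binom(w, x) · e^{−2πiξx} dx = (1 + e^{−2πiξ})^w, where the complex power is taken with the principal branch. -/

import Mathlib

open scoped Real
open MeasureTheory

/-- The generalized binomial coefficient `binom w z = Γ(w+1) / (Γ(z+1) Γ(w-z+1))`. -/
noncomputable def cbinom (w z : ℂ) : ℂ :=
  Complex.Gamma (w + 1) / (Complex.Gamma (z + 1) * Complex.Gamma (w - z + 1))

open Complex Set Filter Topology FourierTransform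

lemma cbinom_symm (w z : ℂ) : cbinom w (w - z) = cbinom w z := by
  simp only [cbinom, sub_sub_cancel]
  rw [mul_comm]

lemma cbinom_eq_betaIntegral {w z : ℂ} (hw : 0 < w.re) (hz : z.re < 0) :
    cbinom w z = -sin (π * z) / π * betaIntegral (-z) (w + 1) := by
  have hw1 : 0 < (w + 1).re := by simp; linarith
  have hz1 : 0 < (-z).re := by simpa using hz
  have hs : 0 < (w - z + 1).re := by simp; linarith
  have hB := Gamma_mul_Gamma_eq_betaIntegral hz1 hw1
  have hR := Gamma_mul_Gamma_one_sub (-z)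
  rw [show -z + (w + 1) = w - z + 1 by ring] at hB
  rw [show 1 - -z = z + 1 by ring, mul_neg, sin_neg] at hR
  have h1 := Gamma_ne_zero_of_re_pos hz1
  have h2 := Gamma_ne_zero_of_re_pos hs
  have hpi : (π : ℂ) ≠ 0 := ofReal_ne_zero.mpr Real.pi_ne_zero
  have hBeq : betaIntegral (-z) (w + 1) =
      Gamma (-z) * Gamma (w + 1) / Gamma (w - z + 1) := by
    rw [hB]; field_simp
  rw [hBeq, cbinom]
  rcases eq_or_ne (sin (π * z)) 0 with h0 | h0
  · rw [h0] at hR ⊢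
    have : Gamma (z + 1) = 0 := by simpa [h1] using hR
    simp [this]
  · have h3 : Gamma (z + 1) ≠ 0 := by
      intro h
      rw [h, mul_zero] at hR
      exact div_ne_zero hpi (neg_ne_zero.mpr h0) hR.symm
    rw [eq_div_iff (neg_ne_zero.mpr h0)] at hR
    generalize sin (π * z) = s at *
    field_simp
    linear_combination (-Gamma (w + 1)) * hR

lemma differentiable_cbinom (w : ℂ) : Differentiable ℂ (cbinom w) := by
  have h := differentiable_one_div_Gamma
  have : cbinom w = fun z ↦
      Gamma (w + 1) * ((Gamma (z + 1))⁻¹ * (Gamma (w - z + 1))⁻¹) := by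
    ext z; rw [cbinom, div_eq_mul_inv, mul_inv]
  rw [this]
  exact ((h.comp (differentiable_id.add_const 1)).mul
    (h.comp ((differentiable_id.const_sub w).add_const 1))).const_mul _

lemma norm_sin_le_exp_abs_im (z : ℂ) : ‖sin z‖ ≤ Real.exp |z.im| := by
  have h1 : ‖exp (-z * I)‖ ≤ Real.exp |z.im| := by
    rw [norm_exp]; simpa using le_abs_self z.im
  have h2 : ‖exp (z * I)‖ ≤ Real.exp |z.im| := by
    rw [norm_exp]; simpa using neg_le_abs z.im
  rw [sin, norm_div, norm_mul, norm_I, mul_one, Complex.norm_ofNat]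
  linarith [norm_sub_le (exp (-z * I)) (exp (z * I))]

lemma norm_betaIntegral_le {u w : ℂ} (hu : 1 < u.re) (hw : 0 < w.re) :
    ‖betaIntegral u (w + 1)‖ ≤
      Real.Gamma (w.re + 1) * (u.re - 1) ^ (-(w.re + 1)) := by
  have hr : 0 < u.re - 1 := by linarith
  have ha : 0 < w.re + 1 := by linarith
  have hval := Real.integral_rpow_mul_exp_neg_mul_Ioi ha hr
  have hint : IntegrableOn (fun t : ℝ ↦ t ^ (w.re + 1 - 1) * Real.exp (-((u.re - 1) * t)))
      (Ioi 0) := by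
    by_contra h
    rw [integral_undef h] at hval
    have : 0 < (1 / (u.re - 1)) ^ (w.re + 1) * Real.Gamma (w.re + 1) :=
      mul_pos (by positivity) (Real.Gamma_pos_of_pos ha)
    linarith
  rw [betaIntegral_symm, betaIntegral]
  calc _ ≤ ∫ t in (0 : ℝ)..1, t ^ (w.re + 1 - 1) * Real.exp (-((u.re - 1) * t)) := by
        refine intervalIntegral.norm_integral_le_of_norm_le zero_le_one ?_ ?_
        · have : ∀ᵐ t : ℝ, t ≠ 1 := by simp [ae_iff]
          filter_upwards [this] with t ht1 ht
          have ht' : 0 < 1 - t := by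
            have := lt_of_le_of_ne ht.2 ht1
            linarith
          rw [norm_mul, norm_cpow_eq_rpow_re_of_pos ht.1,
            show (1 : ℂ) - t = ((1 - t : ℝ) : ℂ) by simp, norm_cpow_eq_rpow_re_of_pos ht']
          simp only [sub_re, add_re, one_re]
          gcongr
          · exact Real.rpow_nonneg ht.1.le _
          · rw [show -((u.re - 1) * t) = -t * (u.re - 1) by ring, Real.exp_mul]
            gcongr
            linarith [Real.add_one_le_exp (-t)]
        · rw [intervalIntegrable_iff_integrableOn_Ioc_of_le zero_le_one]
          exact hint.mono_set Ioc_subset_Ioi_self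
    _ ≤ ∫ t in Ioi (0 : ℝ), t ^ (w.re + 1 - 1) * Real.exp (-((u.re - 1) * t)) := by
        rw [intervalIntegral.integral_of_le zero_le_one]
        refine setIntegral_mono_set hint ?_ Ioc_subset_Ioi_self.eventuallyLE
        filter_upwards [self_mem_ae_restrict measurableSet_Ioi] with t ht
        have : (0 : ℝ) < t := ht
        simp only [Pi.zero_apply]
        positivity
    _ = _ := by
        rw [hval, one_div, Real.inv_rpow hr.le, Real.rpow_neg hr.le, mul_comm]

lemma exists_norm_cbinom_le {w : ℂ} (hw : 0 < w.re) (B : ℝ) :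
    ∃ C, ∀ z : ℂ, z.re < -1 → |z.im| ≤ B →
      ‖cbinom w z‖ ≤ C * (-z.re - 1) ^ (-(w.re + 1)) := by
  refine ⟨Real.exp (π * B) / π * Real.Gamma (w.re + 1), fun z hz hB ↦ ?_⟩
  rw [cbinom_eq_betaIntegral hw (by linarith), norm_mul, norm_div, norm_neg, norm_real,
    Real.norm_of_nonneg Real.pi_pos.le, mul_assoc]
  gcongr
  · refine (norm_sin_le_exp_abs_im _).trans (Real.exp_le_exp.mpr ?_)
    simp only [im_ofReal_mul, abs_mul, abs_of_pos Real.pi_pos]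
    gcongr
  · simpa using norm_betaIntegral_le (u := -z) (by simp; linarith) hw

lemma integrable_cbinom {w : ℂ} (hw : 0 < w.re) :
    Integrable fun x : ℝ ↦ cbinom w x := by
  have hcont : Continuous fun x : ℝ ↦ cbinom w x :=
    (differentiable_cbinom w).continuous.comp continuous_ofReal
  obtain ⟨C, hC⟩ := exists_norm_cbinom_le hw |w.im|
  have hpow : IntegrableOn (fun x : ℝ ↦ x ^ (-(w.re + 1))) (Ioi 1) :=
    integrableOn_Ioi_rpow_of_lt (by linarith) one_pos
  have hleft : IntegrableOn (fun x : ℝ ↦ cbinom w x) (Iio (-2)) := by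
    have h : IntegrableOn (fun x : ℝ ↦ C * (-1 - x) ^ (-(w.re + 1))) (Iio (-2)) := by
      have := (integrable_comp_sub_left
        ((Ioi (1 : ℝ)).indicator fun x : ℝ ↦ x ^ (-(w.re + 1))) (-1) (μ := volume)).mpr
        ((integrable_indicator_iff measurableSet_Ioi).mpr hpow)
      refine Integrable.const_mul ?_ C
      refine this.integrableOn.congr_fun (s := Iio (-2)) (fun x hx ↦ ?_) measurableSet_Iio
      exact indicator_of_mem (by simp only [mem_Iio, mem_Ioi] at *; linarith) _
    refine h.mono' hcont.aestronglyMeasurable ?_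
    filter_upwards [self_mem_ae_restrict measurableSet_Iio] with x hx
    simp only [mem_Iio] at hx
    have := hC x (by simp; linarith) (by simp)
    rwa [ofReal_re, show -x - 1 = -1 - x by ring] at this
  have hright : IntegrableOn (fun x : ℝ ↦ cbinom w x) (Ioi (w.re + 2)) := by
    have h : IntegrableOn (fun x : ℝ ↦ C * (x - (w.re + 1)) ^ (-(w.re + 1)))
        (Ioi (w.re + 2)) := by
      have := ((integrable_indicator_iff measurableSet_Ioi).mpr hpow).comp_sub_right (w.re + 1)
      refine Integrable.const_mul ?_ C
      refine this.integrableOn.congr_fun (s := Ioi (w.re + 2)) (fun x hx ↦ ?_) measurableSet_Ioi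
      exact indicator_of_mem (by simp only [mem_Ioi] at *; linarith) _
    refine h.mono' hcont.aestronglyMeasurable ?_
    filter_upwards [self_mem_ae_restrict measurableSet_Ioi] with x hx
    simp only [mem_Ioi] at hx
    have := hC (w - x) (by simp; linarith) (by simp)
    rwa [cbinom_symm, sub_re, ofReal_re, show -(w.re - x) - 1 = x - (w.re + 1) by ring] at this
  have hmid : IntegrableOn (fun x : ℝ ↦ cbinom w x) (Icc (-2) (w.re + 2)) :=
    hcont.continuousOn.integrableOn_Icc
  rw [← integrableOn_univ]
  refine ((hleft.union hmid).union hright).mono_set fun x _ ↦ ?_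
  simp only [mem_union, mem_Iio, mem_Icc, mem_Ioi]
  grind

lemma integral_exp_pow_mul_exp {x : ℂ} (hx : x.re < 0) (n : ℕ) :
    ∫ ξ in (-(1 / 2) : ℝ)..1 / 2, exp (2 * π * I * ξ) ^ n * exp (-(2 * π * I * ξ * x)) =
      -sin (π * x) / π * ((-1) ^ n / (n - x)) := by
  have hnx : (n : ℂ) - x ≠ 0 := by
    intro h
    have := congrArg re h
    simp at this
    linarith [(Nat.cast_nonneg n : (0 : ℝ) ≤ n)]
  have hpi : (π : ℂ) ≠ 0 := ofReal_ne_zero.mpr Real.pi_ne_zero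
  have hc : 2 * π * I * (n - x) ≠ 0 := by simp [hnx, hpi]
  have hfun : ∀ ξ : ℝ, exp (2 * π * I * ξ) ^ n * exp (-(2 * π * I * ξ * x)) =
      exp (2 * π * I * (n - x) * ξ) := fun ξ ↦ by
    rw [← exp_nat_mul, ← exp_add]; ring_nf
  simp_rw [hfun]
  rw [integral_exp_mul_complex hc]
  have h1 : exp (2 * π * I * (n - x) * ((1 / 2 : ℝ) : ℂ)) = (-1) ^ n * exp (-(π * x) * I) := by
    rw [← exp_pi_mul_I, ← exp_nat_mul, ← exp_add]; push_cast; ring_nf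
  have h2 : exp (2 * π * I * (n - x) * ((-(1 / 2) : ℝ) : ℂ)) = (-1) ^ n * exp (π * x * I) := by
    have : ((-1 : ℂ)) ^ n = exp (n * -(π * I)) := by
      rw [exp_nat_mul, exp_neg, exp_pi_mul_I]; norm_num
    rw [this, ← exp_add]; push_cast; ring_nf
  rw [h1, h2, sin]
  field_simp
  linear_combination (exp (-(π * x * I)) - exp (π * x * I)) * I_sq

lemma integral_power_series_circle {c : ℕ → ℂ} {g : ℂ → ℂ} (hc : Summable fun n ↦ ‖c n‖)
    (hg : ∀ z : ℂ, ‖z‖ ≤ 1 → HasSum (fun n ↦ c n * z ^ n) (g z)) {x : ℂ} (hx : x.re < 0) :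
    ∫ ξ in (-(1 / 2) : ℝ)..1 / 2, g (exp (2 * π * I * ξ)) * exp (-(2 * π * I * ξ * x)) =
      -sin (π * x) / π * ∫ t in (0 : ℝ)..1, (t : ℂ) ^ (-x - 1) * g (-t) := by
  have hcircle : HasSum
      (fun n ↦ ∫ ξ in (-(1 / 2) : ℝ)..1 / 2,
        c n * exp (2 * π * I * ξ) ^ n * exp (-(2 * π * I * ξ * x)))
      (∫ ξ in (-(1 / 2) : ℝ)..1 / 2,
        g (exp (2 * π * I * ξ)) * exp (-(2 * π * I * ξ * x))) := by
    have hnorm : ∀ ξ : ℝ, ‖exp (2 * π * I * ξ)‖ = 1 := fun ξ ↦ by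
      rw [norm_exp]; simp
    refine intervalIntegral.hasSum_integral_of_dominated_convergence
      (fun n ξ ↦ ‖c n‖ * ‖exp (-(2 * π * I * ξ * x))‖) ?_ ?_ ?_ ?_ ?_
    · intro n
      exact Continuous.aestronglyMeasurable (by fun_prop)
    · intro n
      filter_upwards with ξ _
      simp [norm_pow, hnorm]
    · filter_upwards with ξ _
      exact hc.mul_right _
    · simp_rw [tsum_mul_right]
      exact Continuous.intervalIntegrable (by fun_prop) _ _
    · filter_upwards with ξ _
      exact (hg _ (hnorm ξ).le).mul_right _
  have hsegment : HasSum
      (fun n ↦ ∫ t in (0 : ℝ)..1, (t : ℂ) ^ (-x - 1) * (c n * (-t : ℂ) ^ n))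
      (∫ t in (0 : ℝ)..1, (t : ℂ) ^ (-x - 1) * g (-t)) := by
    refine intervalIntegral.hasSum_integral_of_dominated_convergence
      (fun n t ↦ t ^ (-x.re - 1) * ‖c n‖) ?_ ?_ ?_ ?_ ?_
    · intro n
      exact Measurable.aestronglyMeasurable (by fun_prop)
    · intro n
      filter_upwards with t ht
      rw [uIoc_of_le zero_le_one] at ht
      rw [norm_mul, norm_cpow_eq_rpow_re_of_pos ht.1, norm_mul, norm_pow, norm_neg, norm_real,
        Real.norm_of_nonneg ht.1.le]
      simp only [sub_re, neg_re, one_re]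
      have := Real.rpow_nonneg ht.1.le (-x.re - 1)
      gcongr
      exact mul_le_of_le_one_right (norm_nonneg _) (pow_le_one₀ ht.1.le ht.2)
    · filter_upwards with t _
      exact hc.mul_left _
    · simp_rw [tsum_mul_left]
      exact (intervalIntegral.intervalIntegrable_rpow' (by linarith)).mul_const _
    · filter_upwards with t ht
      rw [uIoc_of_le zero_le_one] at ht
      refine (hg _ ?_).mul_left _
      rw [norm_neg, norm_real, Real.norm_of_nonneg ht.1.le]
      exact ht.2
  refine hcircle.unique ?_
  refine Eq.mp (congrArg (fun F ↦ HasSum F _) (funext fun n ↦ ?_)) (hsegment.mul_left (-sin (π * x) / π))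
  symm
  simp_rw [mul_assoc (c n)]
  rw [intervalIntegral.integral_const_mul, integral_exp_pow_mul_exp hx]
  have hmono : ∫ t in (0 : ℝ)..1, (t : ℂ) ^ (-x - 1) * (c n * (-t : ℂ) ^ n) =
      c n * (-1) ^ n * ∫ t in (0 : ℝ)..1, (t : ℂ) ^ (n - x - 1) := by
    rw [← intervalIntegral.integral_const_mul]
    refine intervalIntegral.integral_congr_ae ?_
    filter_upwards with t ht
    rw [uIoc_of_le zero_le_one] at ht
    have ht0 : (t : ℂ) ≠ 0 := ofReal_ne_zero.mpr ht.1.ne'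
    rw [show (n : ℂ) - x - 1 = (-x - 1) + n by ring, cpow_add _ _ ht0, cpow_natCast,
      neg_pow (t : ℂ)]
    ring
  have hre : (0 : ℝ) ≤ n := Nat.cast_nonneg n
  have hnx : (n : ℂ) - x ≠ 0 := by
    intro h
    have := congrArg re h
    simp at this
    linarith
  rw [hmono, integral_cpow (Or.inl (by simp; linarith)), sub_add_cancel, ofReal_one, one_cpow,
    ofReal_zero, zero_cpow hnx]
  ring

lemma integral_circle_eq_integral_segment {g : ℂ → ℂ}
    (hcont : ContinuousOn g (Metric.closedBall 0 1))
    (hdiff : DifferentiableOn ℂ g (Metric.ball 0 1)) {x : ℂ} (hx : x.re < 0) :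
    ∫ ξ in (-(1 / 2) : ℝ)..1 / 2, g (exp (2 * π * I * ξ)) * exp (-(2 * π * I * ξ * x)) =
      -sin (π * x) / π * ∫ t in (0 : ℝ)..1, (t : ℂ) ^ (-x - 1) * g (-t) := by
  obtain ⟨C, hC⟩ := (isCompact_closedBall (0 : ℂ) 1).exists_bound_of_continuousOn hcont
  have hnorm : ∀ ξ : ℝ, ‖exp (2 * π * I * ξ)‖ = 1 := fun ξ ↦ by
    rw [norm_exp]; simp
  have hmem : ∀ r ∈ Ioo (0 : ℝ) 1, ∀ z : ℂ, ‖z‖ ≤ 1 → ‖(r : ℂ) * z‖ < 1 := by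
    intro r hr z hz
    rw [norm_mul, norm_real, Real.norm_of_nonneg hr.1.le]
    exact (mul_le_of_le_one_right hr.1.le hz).trans_lt hr.2
  have hdilate : ∀ r ∈ Ioo (0 : ℝ) 1, ContinuousOn (fun z ↦ g (r * z)) (Metric.closedBall 0 1) :=
    fun r hr ↦ hcont.comp (by fun_prop) fun z hz ↦ by
      simp only [mem_closedBall_zero_iff] at hz ⊢
      exact (hmem r hr z hz).le
  have hlim : ∀ z : ℂ, ‖z‖ ≤ 1 → Tendsto (fun r : ℝ ↦ g (r * z)) (𝓝[<] 1) (𝓝 (g z)) := by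
    intro z hz
    have h1 : Tendsto (fun r : ℝ ↦ (r : ℂ) * z) (𝓝[<] 1) (𝓝 z) := by
      have : Tendsto (fun r : ℝ ↦ (r : ℂ) * z) (𝓝 1) (𝓝 (((1 : ℝ) : ℂ) * z)) :=
        Continuous.tendsto (by fun_prop) 1
      rw [ofReal_one, one_mul] at this
      exact this.mono_left nhdsWithin_le_nhds
    refine (hcont z (by simpa using hz)).tendsto.comp
      (tendsto_nhdsWithin_iff.mpr ⟨h1, ?_⟩)
    filter_upwards [Ioo_mem_nhdsLT one_pos] with r hr
    simpa using (hmem r hr z hz).le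
  have hcirc : Tendsto (fun r : ℝ ↦ ∫ ξ in (-(1 / 2) : ℝ)..1 / 2,
        g (r * exp (2 * π * I * ξ)) * exp (-(2 * π * I * ξ * x))) (𝓝[<] 1)
      (𝓝 (∫ ξ in (-(1 / 2) : ℝ)..1 / 2,
        g (exp (2 * π * I * ξ)) * exp (-(2 * π * I * ξ * x)))) := by
    refine intervalIntegral.tendsto_integral_filter_of_dominated_convergence
      (fun ξ ↦ C * ‖exp (-(2 * π * I * ξ * x))‖) ?_ ?_ ?_ ?_
    · filter_upwards [Ioo_mem_nhdsLT one_pos] with r hr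
      refine Continuous.aestronglyMeasurable (Continuous.mul ?_ (by fun_prop))
      exact (hdilate r hr).comp_continuous (by fun_prop) fun ξ ↦ by simp [hnorm]
    · filter_upwards [Ioo_mem_nhdsLT one_pos] with r hr
      filter_upwards with ξ _
      rw [norm_mul]
      gcongr
      exact hC _ (by simpa using (hmem r hr _ (hnorm ξ).le).le)
    · exact Continuous.intervalIntegrable (by fun_prop) _ _
    · filter_upwards with ξ _
      exact (hlim _ (hnorm ξ).le).mul_const _
  have hnormt : ∀ t ∈ uIoc (0 : ℝ) 1, ‖(-t : ℂ)‖ ≤ 1 := by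
    intro t ht
    rw [uIoc_of_le zero_le_one] at ht
    rw [norm_neg, norm_real, Real.norm_of_nonneg ht.1.le]
    exact ht.2
  have hseg : Tendsto (fun r : ℝ ↦ ∫ t in (0 : ℝ)..1, (t : ℂ) ^ (-x - 1) * g (r * -t)) (𝓝[<] 1)
      (𝓝 (∫ t in (0 : ℝ)..1, (t : ℂ) ^ (-x - 1) * g (-t))) := by
    refine intervalIntegral.tendsto_integral_filter_of_dominated_convergence
      (fun t ↦ t ^ (-x.re - 1) * C) ?_ ?_ ?_ ?_
    · filter_upwards [Ioo_mem_nhdsLT one_pos] with r hr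
      refine AEStronglyMeasurable.mul (Measurable.aestronglyMeasurable (by fun_prop)) ?_
      refine ContinuousOn.aestronglyMeasurable ?_ measurableSet_uIoc
      exact (hdilate r hr).comp (by fun_prop) fun t ht ↦ by simpa using hnormt t ht
    · filter_upwards [Ioo_mem_nhdsLT one_pos] with r hr
      filter_upwards with t ht
      have hg := hC _ (mem_closedBall_zero_iff.mpr (hmem r hr _ (hnormt t ht)).le)
      rw [uIoc_of_le zero_le_one] at ht
      rw [norm_mul, norm_cpow_eq_rpow_re_of_pos ht.1]
      simp only [sub_re, neg_re, one_re]
      have := Real.rpow_nonneg ht.1.le (-x.re - 1)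
      gcongr
    · exact (intervalIntegral.intervalIntegrable_rpow' (by linarith)).mul_const _
    · filter_upwards with t ht
      exact (hlim _ (hnormt t ht)).const_mul _
  refine tendsto_nhds_unique hcirc ((hseg.const_mul (-sin (π * x) / π)).congr' ?_)
  filter_upwards [Ioo_mem_nhdsLT one_pos] with r hr
  have hsum : ∀ z : ℂ, ‖z‖ ≤ 1 → HasSum
      (fun n : ℕ ↦ ((n.factorial : ℂ)⁻¹ * r ^ n * iteratedDeriv n g 0) * z ^ n) (g (r * z)) := by
    intro z hz
    have := hasSum_taylorSeries_on_ball hdiff (z := r * z) (by simpa using hmem r hr z hz)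
    refine Eq.mp (congrArg (fun F ↦ HasSum F _) (funext fun n ↦ ?_)) this
    rw [sub_zero, mul_pow, smul_eq_mul, smul_eq_mul]
    ring
  refine (integral_power_series_circle (g := fun z ↦ g (r * z)) ?_ hsum hx).symm
  have := (hsum 1 (by simp)).summable.norm
  simpa using this

lemma continuousOn_one_add_cpow {w : ℂ} (hw : 0 < w.re) :
    ContinuousOn (fun z : ℂ ↦ (1 + z) ^ w) (Metric.closedBall 0 1) := by
  intro z hz
  have hre : 0 ≤ (1 + z).re := by
    have h1 := abs_le.mp ((abs_re_le_norm z).trans (mem_closedBall_zero_iff.mp hz))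
    simp only [add_re, one_re]
    linarith [h1.1]
  have h := continuousAt_cpow_of_re_pos (p := (1 + z, w)) (Or.inl hre) hw
  exact (h.comp (f := fun z : ℂ ↦ (1 + z, w)) (by fun_prop)).continuousWithinAt

lemma differentiableOn_one_add_cpow (w : ℂ) :
    DifferentiableOn ℂ (fun z : ℂ ↦ (1 + z) ^ w) (Metric.ball 0 1) := by
  intro z hz
  refine DifferentiableAt.differentiableWithinAt
    (DifferentiableAt.cpow_const (by fun_prop) (Or.inl ?_))
  have h1 := abs_lt.mp ((abs_re_le_norm z).trans_lt (mem_ball_zero_iff.mp hz))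
  simp only [add_re, one_re]
  linarith [h1.1]

lemma continuous_one_add_exp_cpow {w : ℂ} (hw : 0 < w.re) :
    Continuous fun ξ : ℝ ↦ (1 + exp (2 * π * I * ξ)) ^ w :=
  (continuousOn_one_add_cpow hw).comp_continuous (f := fun ξ : ℝ ↦ exp (2 * π * I * ξ))
    (by fun_prop) fun ξ ↦ by rw [mem_closedBall_zero_iff, norm_exp]; simp

lemma differentiable_integral_mul_exp {h : ℝ → ℂ} (hh : Continuous h) (a b : ℝ) :
    Differentiable ℂ fun x : ℂ ↦ ∫ ξ in a..b, h ξ * exp (-(2 * π * I * ξ * x)) := by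
  intro x₀
  have hF' : Continuous fun p : ℂ × ℝ ↦
      h p.2 * (exp (-(2 * π * I * p.2 * p.1)) * -(2 * π * I * p.2)) := by fun_prop
  obtain ⟨C, hC⟩ := ((isCompact_closedBall x₀ 1).prod
    (isCompact_uIcc (a := a) (b := b))).exists_bound_of_continuousOn hF'.continuousOn
  refine (intervalIntegral.hasDerivAt_integral_of_dominated_loc_of_deriv_le
    (F' := fun x ξ ↦ h ξ * (exp (-(2 * π * I * ξ * x)) * -(2 * π * I * ξ)))
    (bound := fun _ ↦ C) (Metric.closedBall_mem_nhds x₀ one_pos) ?_ ?_ ?_ ?_ ?_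
    ?_).2.differentiableAt
  · exact .of_forall fun x ↦ Continuous.aestronglyMeasurable (by fun_prop)
  · exact Continuous.intervalIntegrable (by fun_prop) _ _
  · exact Continuous.aestronglyMeasurable (by fun_prop)
  · exact .of_forall fun ξ hξ x hx ↦ hC (x, ξ) ⟨hx, uIoc_subset_uIcc hξ⟩
  · exact intervalIntegrable_const
  · refine .of_forall fun ξ _ x _ ↦ ?_
    have := ((hasDerivAt_id x).const_mul (2 * π * I * ξ)).neg.cexp.const_mul (h ξ)
    simpa using this

lemma integral_one_add_exp_cpow_mul_exp {w : ℂ} (hw : 0 < w.re) (x : ℂ) :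
    ∫ ξ in (-(1 / 2) : ℝ)..1 / 2,
      (1 + exp (2 * π * I * ξ)) ^ w * exp (-(2 * π * I * ξ * x)) = cbinom w x := by
  have hL := differentiable_integral_mul_exp (continuous_one_add_exp_cpow hw) (-(1 / 2)) (1 / 2)
  have hneg : {z : ℂ | z.re < 0} ∈ 𝓝 (-1 : ℂ) :=
    (isOpen_lt continuous_re continuous_const).mem_nhds (by simp)
  refine congrFun (AnalyticOnNhd.eq_of_eventuallyEq (z₀ := -1)
    (fun z _ ↦ hL.analyticAt z) (fun z _ ↦ (differentiable_cbinom w).analyticAt z) ?_) x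
  filter_upwards [hneg] with z hz
  rw [integral_circle_eq_integral_segment (continuousOn_one_add_cpow hw)
    (differentiableOn_one_add_cpow w) hz, cbinom_eq_betaIntegral hw hz, betaIntegral]
  simp only [add_sub_cancel_right]
  simp only [sub_eq_add_neg]

theorem fourier_transform_binom (w : ℂ) (hw : 0 < w.re) (ξ : ℝ) (hξ : |ξ| < 1/2) :
    ∫ x : ℝ, cbinom w (x : ℂ) * Complex.exp (-(2 * π * Complex.I * ξ * x)) =
      (1 + Complex.exp (-(2 * π * Complex.I * ξ))) ^ w := by
  set h : ℝ → ℂ := fun η ↦ (1 + exp (2 * π * I * η)) ^ w with hdef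
  set f : ℝ → ℂ := (Icc (-(1 / 2) : ℝ) (1 / 2)).indicator h with hf
  have hcont : Continuous h := continuous_one_add_exp_cpow hw
  have hw0 : w ≠ 0 := fun h0 ↦ by simp [h0] at hw
  have hfcont : Continuous f := by
    refine continuous_indicator (fun a ha ↦ ?_) hcont.continuousOn
    rw [frontier_Icc (by norm_num)] at ha
    have hexp : exp (2 * π * I * a) = -1 := by
      rcases ha with rfl | rfl
      · rw [show 2 * π * I * ((-(1 / 2) : ℝ) : ℂ) = -(π * I) by push_cast; ring, exp_neg,
          exp_pi_mul_I]
        norm_num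
      · rw [show 2 * π * I * ((1 / 2 : ℝ) : ℂ) = π * I by push_cast; ring, exp_pi_mul_I]
    simp [hdef, hexp, hw0]
  have hfint : Integrable f :=
    (integrable_indicator_iff measurableSet_Icc).mpr hcont.continuousOn.integrableOn_Icc
  have hfourier : 𝓕 f = fun x : ℝ ↦ cbinom w x := by
    ext x
    rw [Real.fourier_real_eq_integral_exp_smul, ← integral_one_add_exp_cpow_mul_exp hw,
      intervalIntegral.integral_of_le (by norm_num), ← integral_Icc_eq_integral_Ioc,
      ← integral_indicator measurableSet_Icc]
    congr 1 with η
    rw [hf, indicator_apply, indicator_apply]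
    split_ifs
    · rw [hdef, smul_eq_mul, mul_comm]
      push_cast
      ring_nf
    · simp
  have hinv := congrFun (hfcont.fourierInv_fourier_eq hfint
    (hfourier ▸ integrable_cbinom hw)) (-ξ)
  have hmem : -ξ ∈ Icc (-(1 / 2) : ℝ) (1 / 2) := by
    have := abs_lt.mp hξ
    constructor <;> linarith
  rw [hfourier, Real.fourierInv_eq', hf, indicator_of_mem hmem] at hinv
  convert hinv using 1
  · congr 1 with x
    simp only [smul_eq_mul, RCLike.inner_apply, conj_trivial]
    rw [mul_comm]
    push_cast
    ring_nf
  · simp [hdef]
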